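/- arXiv:1512.08295 — 2 statements merged into one kernel-verified Lean document; each statement's English description precedes it below -/
import Mathlib

section
/- The product x ∈ S_N of the word x̄ = w̄_m z̄_m w̄_{m−1} z̄_{m−1} ⋯ w̄_1 z̄_1 is minimal in its coset x·W_M; equivalently, ℓ(x·u) = ℓ(x) + ℓ(u) for every u ∈ W_M. -/
/-- The adjacent transposition swapping `i` and `i+1` (0-indexed); the paper's
simple transposition `s_{i+1}`. -/
def sT (n : ℕ) (i : ℕ) : Equiv.Perm (Fin n) :=
  if h : i + 1 < n then Equiv.swap ⟨i, Nat.lt_of_succ_lt h⟩ ⟨i + 1, h⟩ else 1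

/-- Product of a word in the simple transpositions. -/
def wordProd (n : ℕ) (l : List ℕ) : Equiv.Perm (Fin n) := (l.map (sT n)).prod

/-- Number of inversions = Coxeter length. -/
def invLen {n : ℕ} (w : Equiv.Perm (Fin n)) : ℕ :=
  (Finset.univ.filter fun p : Fin n × Fin n => p.1 < p.2 ∧ w p.2 < w p.1).card

/-- `b_i = a_1 + ⋯ + a_i` (with `a_{j+1} = as j`). -/
def bsum (as : ℕ → ℕ) (i : ℕ) : ℕ := ∑ j ∈ Finset.range i, as j

/-- The word `w̄_{i+1} = (s_{k_{i+1}}, …, s_{n−1})`, 0-indexed: letters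
`cs i, cs i + 1, …, n − 2` where `cs i = k_{i+1} − 1`. -/
def wbar (n : ℕ) (cs : ℕ → ℕ) (i : ℕ) : List ℕ := List.range' (cs i) (n - 1 - cs i)

/-- The word `z̄_{i+1}`: the concatenation, for `j` running from `b_{i+1} − 1` down to
`b_i`, of the blocks `(s_n, s_{n+1}, …, s_{n+j})` (0-indexed letters
`n − 1, n, …, n − 1 + j`). -/
def zbar (n : ℕ) (as : ℕ → ℕ) (i : ℕ) : List ℕ :=
  ((List.range (as i)).map fun t => List.range' (n - 1) (bsum as (i + 1) - t)).flatten

/-- The concatenated word `x̄ = w̄_m z̄_m w̄_{m−1} z̄_{m−1} ⋯ w̄_1 z̄_1`. -/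
def xbar (n m : ℕ) (cs as : ℕ → ℕ) : List ℕ :=
  ((List.range m).map fun t => wbar n cs (m - 1 - t) ++ zbar n as (m - 1 - t)).flatten

theorem sT_apply_of_ne {N a : ℕ} {p : Fin N} (h₁ : p.val ≠ a) (h₂ : p.val ≠ a + 1) :
    sT N a p = p := by
  unfold sT
  split_ifs with h
  · exact Equiv.swap_apply_of_ne_of_ne (by simpa [Fin.ext_iff] using h₁)
      (by simpa [Fin.ext_iff] using h₂)
  · rfl

theorem sT_apply_left {N a : ℕ} (h : a + 1 < N) {p : Fin N} (hp : p.val = a) :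
    (sT N a p).val = a + 1 := by
  have hp' : p = ⟨a, Nat.lt_of_succ_lt h⟩ := Fin.ext hp
  simp [sT, h, hp']

theorem wordProd_append (N : ℕ) (l₁ l₂ : List ℕ) :
    wordProd N (l₁ ++ l₂) = wordProd N l₁ * wordProd N l₂ := by
  simp [wordProd]

theorem wordProd_cons (N a : ℕ) (l : List ℕ) : wordProd N (a :: l) = sT N a * wordProd N l := by
  simp [wordProd]

theorem wordProd_range'_apply_of_lt_or_gt {N : ℕ} (L a : ℕ) (p : Fin N)
    (hp : p.val < a ∨ a + L < p.val) : wordProd N (List.range' a L) p = p := by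
  induction L generalizing a with
  | zero => simp [wordProd]
  | succ L ih =>
    rw [List.range'_succ, wordProd_cons, Equiv.Perm.mul_apply, ih _ (by omega),
      sT_apply_of_ne (by omega) (by omega)]

theorem wordProd_range'_apply_of_mem {N : ℕ} (L a : ℕ) (h : a + L < N) (p : Fin N)
    (h₁ : a ≤ p.val) (h₂ : p.val < a + L) :
    (wordProd N (List.range' a L) p).val = p.val + 1 := by
  induction L generalizing a with
  | zero => omega
  | succ L ih =>
    rw [List.range'_succ, wordProd_cons, Equiv.Perm.mul_apply]
    rcases h₁.eq_or_lt with h₁ | h₁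
    · rw [wordProd_range'_apply_of_lt_or_gt _ _ _ (by omega), sT_apply_left (by omega) h₁.symm, h₁]
    · have := ih (a + 1) (by omega) h₁ (by omega)
      rw [sT_apply_of_ne (by omega) (by omega), this]

/-- A product of `k` nested cycles fixes what lies below `c`. -/
theorem wordProd_blocks_apply_of_lt {N : ℕ} (c B k : ℕ) (p : Fin N) (hp : p.val < c) :
    wordProd N ((List.range k).map fun t => List.range' c (B - t)).flatten p = p := by
  induction k with
  | zero => simp [wordProd]
  | succ k ih =>
    rw [List.range_succ, List.map_append, List.flatten_append, wordProd_append,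
      Equiv.Perm.mul_apply]
    simp only [List.map_cons, List.map_nil, List.flatten_cons, List.flatten_nil, List.append_nil]
    rw [wordProd_range'_apply_of_lt_or_gt _ _ _ (Or.inl hp), ih]

/-- A product of `k` nested cycles shifts the first points of their common support by `k`. -/
theorem wordProd_blocks_apply_of_le {N : ℕ} (c B k : ℕ) (hN : c + B < N) (p : Fin N)
    (h₁ : c ≤ p.val) (h₂ : p.val + k ≤ c + B) :
    (wordProd N ((List.range k).map fun t => List.range' c (B - t)).flatten p).val =
      p.val + k := by
  induction k generalizing p with
  | zero => simp [wordProd]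
  | succ k ih =>
    rw [List.range_succ, List.map_append, List.flatten_append, wordProd_append,
      Equiv.Perm.mul_apply]
    simp only [List.map_cons, List.map_nil, List.flatten_cons, List.flatten_nil, List.append_nil]
    have := wordProd_range'_apply_of_mem (B - k) c (by omega) p h₁ (by omega)
    rw [ih _ (by omega) (by omega), this]
    omega

theorem bsum_succ (as : ℕ → ℕ) (i : ℕ) : bsum as (i + 1) = bsum as i + as i :=
  Finset.sum_range_succ as i

theorem xbar_succ (n m : ℕ) (cs as : ℕ → ℕ) :
    xbar n (m + 1) cs as = (wbar n cs m ++ zbar n as m) ++ xbar n m cs as := by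
  simp only [xbar, List.range_succ_eq_map, List.map_cons, List.map_map, List.flatten_cons]
  congr 3
  funext t
  simp only [Function.comp]
  rw [show m + 1 - 1 - t.succ = m - 1 - t by omega]

/-- The factor `w̄ z̄` on `{0, …, n - 1 + bsum as i}`. -/
theorem wordProd_wbar_append_zbar_val {n N : ℕ} (as cs : ℕ → ℕ) (i : ℕ) (hpos : 0 < as i)
    (hc : cs i + 2 ≤ n) (hN : n + bsum as (i + 1) ≤ N) (p : Fin N)
    (hp : p.val < n + bsum as i) :
    (wordProd N (wbar n cs i ++ zbar n as i) p).val =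
      if p.val < cs i then p.val else if p.val < n - 1 then p.val + 1 else p.val + as i := by
  have hb := bsum_succ as i
  rw [wordProd_append, Equiv.Perm.mul_apply, wbar, zbar]
  rcases lt_or_ge p.val (n - 1) with h | h
  · rw [wordProd_blocks_apply_of_lt _ _ _ _ h]
    split_ifs with h₁
    · rw [wordProd_range'_apply_of_lt_or_gt _ _ _ (Or.inl h₁)]
    · exact wordProd_range'_apply_of_mem _ _ (by omega) _ (by omega) (by omega)
  · have hz := wordProd_blocks_apply_of_le (n - 1) (bsum as (i + 1)) (as i) (by omega) p h
      (by omega)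
    rw [wordProd_range'_apply_of_lt_or_gt _ _ _ (by omega), hz, if_neg (by omega),
      if_neg (by omega)]

/-- The permutation `x` is strictly increasing on the first `n` points. -/
theorem wordProd_xbar_lt {n N : ℕ} (m : ℕ) (as cs : ℕ → ℕ)
    (hpos : ∀ i < m, 0 < as i) (hcs : ∀ i < m, cs i + 2 ≤ n) (hN : n + bsum as m ≤ N)
    (p q : Fin N) (hpq : p < q) (hq : q.val < n) :
    wordProd N (xbar n m cs as) p < wordProd N (xbar n m cs as) q ∧
      (wordProd N (xbar n m cs as) q).val < n + bsum as m := by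
  induction m with
  | zero => simpa [xbar, wordProd, bsum] using And.intro hpq hq
  | succ m ih =>
    have hb := bsum_succ as m
    obtain ⟨h₁, h₂⟩ := ih (fun i hi => hpos i (by omega)) (fun i hi => hcs i (by omega)) (by omega)
    rw [xbar_succ, wordProd_append, Equiv.Perm.mul_apply, Equiv.Perm.mul_apply]
    have hval := wordProd_wbar_append_zbar_val as cs m (hpos m (by omega)) (hcs m (by omega)) hN
    rw [Fin.lt_def] at h₁ ⊢
    rw [hval _ (h₁.trans h₂), hval _ h₂]
    have := hpos m (by omega)
    split_ifs <;> omega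

theorem apply_eq_self_of_mem_closure {n N : ℕ} {u : Equiv.Perm (Fin N)}
    (hu : u ∈ Subgroup.closure ((fun i => sT N i) '' {i : ℕ | i + 1 < n})) (p : Fin N)
    (hp : n ≤ p.val) : u p = p := by
  have h : Subgroup.closure ((fun i => sT N i) '' {i : ℕ | i + 1 < n}) ≤
      MulAction.stabilizer (Equiv.Perm (Fin N)) p := by
    rw [Subgroup.closure_le]
    rintro _ ⟨i, hi, rfl⟩
    simp only [Set.mem_ofPred_eq] at hi
    exact sT_apply_of_ne (by omega) (by omega)
  exact h hu

/-- A permutation increasing on the first `n` points is length-additive with permutations of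
these points. -/
theorem invLen_mul_of_lt {n N : ℕ} (x u : Equiv.Perm (Fin N))
    (hx : ∀ p q : Fin N, p < q → q.val < n → x p < x q)
    (hu : ∀ p : Fin N, n ≤ p.val → u p = p) : invLen (x * u) = invLen x + invLen u := by
  have hlt (p : Fin N) (hp : p.val < n) : (u p).val < n := by
    by_contra! h
    have := u.injective (hu _ h)
    omega
  have hinv (p q : Fin N) (hpq : p < q) (h : u q < u p) : q.val < n := by
    by_contra! hq
    rw [hu q hq] at h
    rcases lt_or_ge p.val n with hp | hp
    · have := hlt p hp
      omega
    · rw [hu p hp] at h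
      omega
  unfold invLen
  rw [← Finset.card_filter_add_card_filter_not (fun p : Fin N × Fin N => u p.1 < u p.2),
    Finset.filter_filter, Finset.filter_filter]
  congr 1
  · refine Finset.card_bij (fun p _ => (u p.1, u p.2)) ?_ ?_ ?_
    · intro p h
      rw [Finset.mem_filter] at h ⊢
      exact ⟨Finset.mem_univ _, h.2.2, h.2.1.2⟩
    · rintro ⟨p, q⟩ _ ⟨p', q'⟩ _ h
      simpa using h
    · rintro ⟨p, q⟩ h
      simp only [Finset.mem_filter, Finset.mem_univ, true_and] at h
      refine ⟨(u.symm p, u.symm q), ?_, by simp⟩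
      rw [Finset.mem_filter]
      simp only [Finset.mem_univ, true_and, Equiv.Perm.mul_apply, Equiv.apply_symm_apply]
      refine ⟨⟨?_, h.2⟩, h.1⟩
      by_contra! hle
      have hne : u.symm q ≠ u.symm p := fun e => h.1.ne' (u.symm.injective e)
      have hp := hinv _ _ (lt_of_le_of_ne hle hne) (by simpa using h.1)
      have hq := hlt _ (lt_of_le_of_lt hle hp)
      rw [Equiv.apply_symm_apply] at hq
      exact lt_asymm (hx _ _ h.1 hq) h.2
  · congr 1
    ext ⟨p, q⟩
    simp only [Finset.mem_filter, Finset.mem_univ, true_and, Equiv.Perm.mul_apply, not_lt]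
    constructor
    · rintro ⟨⟨hpq, _⟩, hle⟩
      exact ⟨hpq, lt_of_le_of_ne hle fun e => hpq.ne' (u.injective e)⟩
    · rintro ⟨hpq, h⟩
      exact ⟨⟨hpq, hx _ _ h (hlt p (lt_trans hpq (hinv p q hpq h)))⟩, h.le⟩


/-- the product `x ∈ S_N` of `x̄ = w̄_m z̄_m ⋯ w̄_1 z̄_1` is minimal in its
coset `x·W_M`: `ℓ(x·u) = ℓ(x) + ℓ(u)` for every `u ∈ W_M`, where `W_M` is generated by
`s_1,…,s_{n−1}` (0-indexed letters `i` with `i + 1 < n`). -/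
theorem stmt12 (n m : ℕ) (hn : 2 ≤ n) (hm : 1 ≤ m) (as cs : ℕ → ℕ)
    (hpos : ∀ i < m, 0 < as i) (hcs : ∀ i < m, cs i + 2 ≤ n)
    (N : ℕ) (hN : N = n + bsum as m)
    (hsum : ∑ i ∈ Finset.range m, invLen (wordProd N (wbar n cs i)) = bsum as m) :
    ∀ u ∈ Subgroup.closure ((fun i => sT N i) '' {i : ℕ | i + 1 < n}),
      invLen (wordProd N (xbar n m cs as) * u) =
        invLen (wordProd N (xbar n m cs as)) + invLen u := by
  intro u hu
  exact invLen_mul_of_lt _ u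
    (fun p q hpq hq => (wordProd_xbar_lt m as cs hpos hcs hN.ge p q hpq hq).1)
    (apply_eq_self_of_mem_closure hu)
end

section
/- Write the word x̄ as (t_1,…,t_ℓ) with each t_i a simple transposition of S_N. Let e = (e_1,…,e_ℓ) ∈ {0,1}^ℓ be any subexpression such that the product t_1^{e_1} t_2^{e_2} ⋯ t_ℓ^{e_ℓ} lies in the coset w_A·W_M. Then e_i = 1 for every position i with t_i ∈ A = {s_{n+1},…,s_{n+a−1}}, and e_i = 0 for every position i with t_i = s_n. -/
/-- The product `t_1^{e_1} t_2^{e_2} ⋯ t_ℓ^{e_ℓ}` of the subexpression `e` of the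
word `ts`. -/
def subProd (N : ℕ) (ts : List ℕ) (e : List Bool) : Equiv.Perm (Fin N) :=
  (List.zipWith (fun t b => if b then sT N t else 1) ts e).prod

theorem sT_val {N i : ℕ} (h : i + 1 < N) (x : Fin N) :
    (sT N i x).val = if x.val = i then i + 1 else if x.val = i + 1 then i else x.val := by
  unfold sT
  rw [dif_pos h, Equiv.swap_apply_def]
  simp only [Fin.ext_iff]
  split_ifs <;> simp_all

theorem sT_fix {N i : ℕ} (x : Fin N) (h₁ : x.val ≠ i) (h₂ : x.val ≠ i + 1) : sT N i x = x := by
  by_cases h : i + 1 < N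
  · exact Fin.ext (by rw [sT_val h, if_neg h₁, if_neg h₂])
  · simp [sT, h]

theorem subProd_cons (N t : ℕ) (ts : List ℕ) (b : Bool) (e : List Bool) :
    subProd N (t :: ts) (b :: e) = (if b then sT N t else 1) * subProd N ts e := by
  simp [subProd]

theorem subProd_append (N : ℕ) (l₁ l₂ : List ℕ) (e₁ e₂ : List Bool)
    (h : e₁.length = l₁.length) :
    subProd N (l₁ ++ l₂) (e₁ ++ e₂) = subProd N l₁ e₁ * subProd N l₂ e₂ := by
  simp [subProd, List.zipWith_append h.symm]

/-- A subexpression fixes every point not moved by any letter of the word. -/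
theorem subProd_fix {N : ℕ} (x : Fin N) (l : List ℕ) (e : List Bool)
    (h : ∀ t ∈ l, x.val ≠ t ∧ x.val ≠ t + 1) : subProd N l e x = x := by
  induction l generalizing e with
  | nil => simp [subProd]
  | cons t l ih =>
    cases e with
    | nil => simp [subProd]
    | cons b e =>
      rw [subProd_cons, Equiv.Perm.mul_apply, ih e fun t ht => h t (List.mem_cons_of_mem _ ht)]
      obtain ⟨h₁, h₂⟩ := h t List.mem_cons_self
      cases b
      · simp
      · simpa using sT_fix x h₁ h₂

/-- A subexpression of an ascending run `s, …, s + k - 1` sends `s + k` to a point `≥ s`, and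
only the full subexpression sends it to `s`. -/
theorem subProd_run_last {N : ℕ} (k s : ℕ) (e : List Bool) (he : e.length = k) (x : Fin N)
    (hx : x.val = s + k) :
    s ≤ (subProd N (List.range' s k) e x).val ∧
      ((subProd N (List.range' s k) e x).val = s → ∀ b ∈ e, b = true) := by
  induction k generalizing s e with
  | zero =>
    obtain rfl := List.length_eq_zero_iff.mp he
    simp [subProd, hx]
  | succ k ih =>
    obtain ⟨b, e, rfl⟩ := List.exists_cons_of_length_eq_add_one he
    obtain ⟨h₁, h₂⟩ := ih (s + 1) e (by simpa using he) (by omega)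
    have hlt : s + 1 < N := by have := x.isLt; omega
    rw [List.range'_succ, subProd_cons, Equiv.Perm.mul_apply]
    cases b
    · simp only [Bool.false_eq_true, if_false, Equiv.Perm.one_apply]
      exact ⟨by omega, fun h => by omega⟩
    · simp only [if_true]
      rw [sT_val hlt]
      refine ⟨by split_ifs <;> omega, fun h => ?_⟩
      have : (subProd N (List.range' (s + 1) k) e x).val = s + 1 := by
        split_ifs at h <;> omega
      simpa using h₂ this

/-- The product of the full ascending run `s, …, s + k - 1` shifts `s, …, s + k - 1` up by one. -/
theorem subProd_run_shift {N : ℕ} (k s : ℕ) (e : List Bool) (he : e.length = k)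
    (htrue : ∀ b ∈ e, b = true) (hN : s + k < N) (x : Fin N) (hs : s ≤ x.val)
    (hx : x.val < s + k) :
    (subProd N (List.range' s k) e x).val = x.val + 1 := by
  induction k generalizing s e with
  | zero => omega
  | succ k ih =>
    obtain ⟨b, e, rfl⟩ := List.exists_cons_of_length_eq_add_one he
    obtain rfl : b = true := htrue b List.mem_cons_self
    rw [List.range'_succ, subProd_cons, Equiv.Perm.mul_apply, if_pos rfl, sT_val (by omega)]
    rcases hs.eq_or_lt with h | h
    · rw [subProd_fix]
      · simp [h]
      · intro t ht
        rw [List.mem_range'_1] at ht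
        omega
    · rw [ih (s + 1) e (by simpa using he) (fun b hb => htrue b (List.mem_cons_of_mem _ hb))
        (by omega) h (by omega), if_neg (by omega), if_neg (by omega)]

/-- Words made of the blocks `n - 1, …, n - 1 + i` for `i = j - 1, …, 0`, in this order,
interspersed with letters smaller than `n - 1`. -/
inductive IsStaircase (n : ℕ) : ℕ → List ℕ → Prop
  | nil : IsStaircase n 0 []
  | cons {j i : ℕ} {l : List ℕ} (hi : i + 1 < n) (h : IsStaircase n j l) :
      IsStaircase n j (i :: l)
  | block {j : ℕ} {l : List ℕ} (h : IsStaircase n j l) :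
      IsStaircase n (j + 1) (List.range' (n - 1) (j + 1) ++ l)

namespace IsStaircase

variable {n j : ℕ} {l : List ℕ}

theorem letter_lt (hn : 1 ≤ n) (h : IsStaircase n j l) : ∀ t ∈ l, t + 1 < n + j := by
  induction h with
  | nil => simp
  | cons hi h ih =>
    intro t ht
    rcases List.mem_cons.mp ht with rfl | ht
    · omega
    · exact ih t ht
  | block h ih =>
    intro t ht
    rcases List.mem_append.mp ht with ht | ht
    · rw [List.mem_range'_1] at ht
      omega
    · have := ih t ht
      omega

theorem append_left (h : IsStaircase n j l) (w : List ℕ) (hw : ∀ t ∈ w, t + 1 < n) :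
    IsStaircase n j (w ++ l) := by
  induction w with
  | nil => exact h
  | cons t w ih =>
    exact .cons (hw t List.mem_cons_self) (ih fun t ht => hw t (List.mem_cons_of_mem _ ht))

theorem blocks (k B : ℕ) (hk : k ≤ B) (h : IsStaircase n (B - k) l) :
    IsStaircase n B
      (((List.range k).map fun t => List.range' (n - 1) (B - t)).flatten ++ l) := by
  induction k generalizing l with
  | zero => simpa using h
  | succ k ih =>
    have h' := ih (by omega) (l := List.range' (n - 1) (B - k) ++ l) (by
      have := h.block
      rwa [show B - (k + 1) + 1 = B - k by omega] at this)
    simpa [List.range_succ] using h'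

/-- A subexpression of a staircase word whose product reverses `n, …, n + j - 1` uses every
letter `≥ n` and omits every letter `n - 1`. -/
theorem subexpression {N : ℕ} (hn : 1 ≤ n) (h : IsStaircase n j l) (hN : n + j ≤ N)
    (e : List Bool) (he : e.length = l.length)
    (hrev : ∀ x : Fin N, n ≤ x.val → x.val < n + j →
      (subProd N l e x).val + x.val + 1 = 2 * n + j) :
    ∀ p ∈ l.zip e, (n ≤ p.1 → p.2 = true) ∧ (p.1 = n - 1 → p.2 = false) := by
  induction h generalizing e with
  | nil => simp
  | @cons j i l hi h ih =>
    obtain ⟨b, e, rfl⟩ := List.exists_cons_of_length_eq_add_one he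
    intro p hp
    rw [List.zip_cons_cons, List.mem_cons] at hp
    rcases hp with rfl | hp
    · exact ⟨fun _ => by simp at *; omega, fun _ => by simp at *; omega⟩
    · refine ih hN e (by simpa using he) (fun x hx hxj => ?_) p hp
      have hx' := hrev x hx hxj
      rw [subProd_cons, Equiv.Perm.mul_apply] at hx'
      cases b
      · simpa using hx'
      · simp only [if_true] at hx'
        rw [sT_val (by omega)] at hx'
        split_ifs at hx' <;> omega
  | @block j l h ih =>
    obtain ⟨e₁, e₂, rfl, he₁⟩ : ∃ e₁ e₂, e = e₁ ++ e₂ ∧ e₁.length = j + 1 :=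
      ⟨e.take (j + 1), e.drop (j + 1), (List.take_append_drop _ _).symm, by simp [he]⟩
    have he₂ : e₂.length = l.length := by simpa [he₁] using he
    obtain ⟨b, e₁, rfl⟩ := List.exists_cons_of_length_eq_add_one he₁
    have he₁' : e₁.length = j := by simpa using he₁
    have hrun : List.range' (n - 1) (j + 1) = (n - 1) :: List.range' n j := by
      rw [List.range'_succ, Nat.sub_add_cancel hn]
    simp only [hrun] at hrev ⊢
    simp only [subProd_append N ((n - 1) :: List.range' n j) l (b :: e₁) e₂ (by simp [he₁']),
      subProd_cons, Equiv.Perm.mul_apply] at hrev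
    have hlt : n - 1 + 1 < N := by omega
    have hlast := hrev ⟨n + j, by omega⟩ (by simp) (by simp)
    rw [subProd_fix (N := N) ⟨n + j, by omega⟩ l e₂ (fun t ht => by
      have := h.letter_lt hn t ht
      simp only
      omega)] at hlast
    obtain ⟨hge, htrue⟩ := subProd_run_last (N := N) j n e₁ he₁' ⟨n + j, by omega⟩ rfl
    have hb : b = false := by
      cases b
      · rfl
      · simp only [if_true] at hlast
        rw [sT_val hlt] at hlast
        split_ifs at hlast <;> omega
    subst hb
    simp only [Bool.false_eq_true, if_false, Equiv.Perm.one_apply] at hlast hrev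
    have htrue := htrue (by omega)
    have hshift := subProd_run_shift (N := N) j n e₁ he₁' htrue (by omega)
    intro p hp
    rw [List.zip_append (by simp [he₁']), List.mem_append, List.zip_cons_cons,
      List.mem_cons] at hp
    rcases hp with (rfl | hp) | hp
    · exact ⟨fun h => by simp only at h; omega, fun _ => rfl⟩
    · have h₁ := (List.mem_range'_1.mp (List.of_mem_zip hp).1).1
      exact ⟨fun _ => htrue _ (List.of_mem_zip hp).2, fun h => by omega⟩
    · refine ih (by omega) e₂ he₂ (fun x hx hxj => ?_) p hp
      have hx' := hrev x hx (by omega)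
      set y := subProd N l e₂ x
      have hz := hshift ⟨2 * n + j - 1 - x.val, by omega⟩ (by simp only; omega)
        (by simp only; omega)
      have : y = ⟨2 * n + j - 1 - x.val, by omega⟩ := by
        apply (subProd N (List.range' n j) e₁).injective
        apply Fin.ext
        rw [hz]
        simp only
        omega
      rw [this]
      simp only
      omega

end IsStaircase

theorem isStaircase_xbar (n m : ℕ) (as cs : ℕ → ℕ) (hcs : ∀ i < m, cs i + 2 ≤ n) :
    IsStaircase n (bsum as m) (xbar n m cs as) := by
  induction m with
  | zero => simpa [bsum, xbar] using IsStaircase.nil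
  | succ m ih =>
    have hx : xbar n (m + 1) cs as = wbar n cs m ++ (zbar n as m ++ xbar n m cs as) := by
      simp only [xbar, List.range_succ_eq_map, List.map_cons, List.map_map, List.flatten_cons,
        List.append_assoc, Nat.add_sub_cancel, Nat.sub_zero]
      congr 4
      funext t
      simp [show m - (t + 1) = m - 1 - t by omega]
    have hb : bsum as (m + 1) = bsum as m + as m := Finset.sum_range_succ _ _
    rw [hx]
    refine IsStaircase.append_left (IsStaircase.blocks _ _ (by omega) ?_) _ fun t ht => ?_
    · rw [hb, Nat.add_sub_cancel]
      exact ih fun i hi => hcs i (by omega)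
    · have := hcs m (by omega)
      rw [wbar, List.mem_range'_1] at ht
      omega

/-- Multiplying by a simple transposition at an ascent increases the number of inversions. -/
theorem invLen_lt_mul_sT {N i : ℕ} (h : i + 1 < N) (w : Equiv.Perm (Fin N))
    (hw : w ⟨i, by omega⟩ < w ⟨i + 1, h⟩) : invLen w < invLen (w * sT N i) := by
  have hinv : ∀ x, sT N i (sT N i x) = x := fun x => by simp [sT, h]
  unfold invLen
  rw [← Finset.card_map ((sT N i).prodCongr (sT N i)).toEmbedding]
  apply Finset.card_lt_card
  rw [Finset.ssubset_iff_of_subset]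
  · refine ⟨(⟨i, by omega⟩, ⟨i + 1, h⟩), ?_, ?_⟩
    · simpa [sT, h] using hw
    · simp only [Finset.mem_map_equiv, Finset.mem_filter, Finset.mem_univ, true_and, not_and]
      intro h'
      simp [sT, h, Fin.lt_def] at h'
  · rintro ⟨p, q⟩ hpq
    simp only [Finset.mem_map, Finset.mem_filter, Finset.mem_univ, true_and, Prod.exists,
      Equiv.coe_toEmbedding, Equiv.prodCongr_apply, Prod.map_apply, Prod.mk.injEq] at hpq ⊢
    obtain ⟨p', q', ⟨hlt, hw'⟩, rfl, rfl⟩ := hpq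
    refine ⟨?_, by simpa [hinv] using hw'⟩
    have hne : ¬ (p'.val = i ∧ q'.val = i + 1) := by
      rintro ⟨h₁, h₂⟩
      have hp : p' = ⟨i, Nat.lt_of_succ_lt h⟩ := Fin.ext h₁
      have hq : q' = ⟨i + 1, h⟩ := Fin.ext h₂
      rw [hp, hq] at hw'
      exact hw'.not_gt hw
    rw [Fin.lt_def] at hlt ⊢
    rw [sT_val h, sT_val h]
    split_ifs <;> omega

/-- An element of maximal length in the parabolic subgroup on the letters `n, …, n + a - 2`
reverses `n, …, n + a - 1`. -/
theorem longest_apply {n a N : ℕ} (hN : N = n + a) (w : Equiv.Perm (Fin N))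
    (hmem : w ∈ Subgroup.closure ((fun i => sT N i) '' {i : ℕ | n ≤ i ∧ i + 2 ≤ n + a}))
    (hmax : ∀ u ∈ Subgroup.closure ((fun i => sT N i) '' {i : ℕ | n ≤ i ∧ i + 2 ≤ n + a}),
      invLen u ≤ invLen w) (x : Fin N) (hx : n ≤ x.val) :
    (w x).val + x.val + 1 = 2 * n + a := by
  have hge : ∀ x : Fin N, n ≤ x.val ↔ n ≤ (w x).val := by
    clear hmax
    induction hmem using Subgroup.closure_induction with
    | mem u hu =>
      obtain ⟨i, ⟨hi, hi'⟩, rfl⟩ := hu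
      intro x
      simp only
      rw [sT_val (by omega)]
      split_ifs <;> omega
    | one => simp
    | mul u v _ _ hu hv => exact fun x => (hv x).trans (hu _)
    | inv u _ hu => exact fun x => by simpa using (hu (u⁻¹ x)).symm
  have hdesc : ∀ (i : ℕ) (h : i + 1 < N), n ≤ i →
      (w ⟨i + 1, h⟩).val < (w ⟨i, by omega⟩).val := by
    intro i h hi
    by_contra hcon
    have hne : w ⟨i, by omega⟩ ≠ w ⟨i + 1, h⟩ := fun h' => by
      simpa [Fin.ext_iff] using w.injective h'
    have hlt : w ⟨i, by omega⟩ < w ⟨i + 1, h⟩ := lt_of_le_of_ne (not_lt.mp hcon) hne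
    have := hmax (w * sT N i)
      (mul_mem hmem (Subgroup.subset_closure ⟨i, ⟨hi, by omega⟩, rfl⟩))
    exact absurd (invLen_lt_mul_sT h w hlt) (not_lt.mpr this)
  have hup : ∀ (k : ℕ) (h : n + k < N), (w ⟨n + k, h⟩).val + (n + k) + 1 ≤ 2 * n + a := by
    intro k
    induction k with
    | zero => intro h; have := (w ⟨n + 0, h⟩).isLt; omega
    | succ k ih =>
      intro h
      have h₁ := ih (by omega)
      have h₂ := hdesc (n + k) h (by omega)
      simp only [← add_assoc] at *
      omega
  have hdown : ∀ (k y : ℕ) (h : y < N), n ≤ y → y + k + 1 = N →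
      2 * n + a ≤ (w ⟨y, h⟩).val + y + 1 := by
    intro k
    induction k with
    | zero => intro y h hy hk; have := (hge ⟨y, h⟩).mp hy; omega
    | succ k ih =>
      intro y h hy hk
      have h₁ := ih (y + 1) (by omega) (by omega) (by omega)
      have h₂ := hdesc y (by omega) hy
      omega
  have h₁ := hup (x.val - n) (by omega)
  have h₂ := hdown (N - 1 - x.val) x.val x.isLt hx (by omega)
  simp only [Nat.add_sub_cancel' hx, Fin.eta] at h₁ h₂
  omega

/-- if a subexpression `e` of `x̄ = (t_1,…,t_ℓ)` has product lying in the
coset `w_A·W_M`, then `e_i = 1` whenever `t_i ∈ A = {s_{n+1},…,s_{n+a−1}}` (0-indexed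
letters `t` with `n ≤ t` and `t + 2 ≤ n + a`) and `e_i = 0` whenever `t_i = s_n`
(0-indexed letter `n − 1`).  Here `w_A` is the longest element of `W_A`. -/
theorem stmt13 (n m : ℕ) (hn : 2 ≤ n) (hm : 1 ≤ m) (as cs : ℕ → ℕ)
    (hpos : ∀ i < m, 0 < as i) (hcs : ∀ i < m, cs i + 2 ≤ n)
    (N : ℕ) (hN : N = n + bsum as m)
    (hsum : ∑ i ∈ Finset.range m, invLen (wordProd N (wbar n cs i)) = bsum as m)
    (wA : Equiv.Perm (Fin N))
    (hwA : wA ∈ Subgroup.closure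
        ((fun i => sT N i) '' {i : ℕ | n ≤ i ∧ i + 2 ≤ n + bsum as m}) ∧
      ∀ u ∈ Subgroup.closure
        ((fun i => sT N i) '' {i : ℕ | n ≤ i ∧ i + 2 ≤ n + bsum as m}),
        invLen u ≤ invLen wA)
    (e : List Bool) (he : e.length = (xbar n m cs as).length)
    (hcoset : ∃ u ∈ Subgroup.closure ((fun i => sT N i) '' {i : ℕ | i + 1 < n}),
      subProd N (xbar n m cs as) e = wA * u) :
    ∀ p ∈ (xbar n m cs as).zip e,
      (n ≤ p.1 ∧ p.1 + 2 ≤ n + bsum as m → p.2 = true) ∧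
      (p.1 = n - 1 → p.2 = false) := by
  have hu_fix : ∀ u ∈ Subgroup.closure ((fun i => sT N i) '' {i : ℕ | i + 1 < n}),
      ∀ x : Fin N, n ≤ x.val → u x = x := by
    intro u hu
    induction hu using Subgroup.closure_induction with
    | mem u hu =>
      obtain ⟨i, hi, rfl⟩ := hu
      have hi : i + 1 < n := hi
      exact fun x hx => sT_fix x (by omega) (by omega)
    | one => simp
    | mul u v _ _ hu hv => exact fun x hx => by rw [Equiv.Perm.mul_apply, hv x hx, hu x hx]
    | inv u _ hu => exact fun x hx => by rw [Equiv.Perm.inv_eq_iff_eq, hu x hx]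
  obtain ⟨u, hu, hprod⟩ := hcoset
  have hst := (isStaircase_xbar n m as cs hcs).subexpression (N := N) (by omega) hN.ge e he
    fun x hx _ => by
      rw [hprod, Equiv.Perm.mul_apply, hu_fix u hu x hx]
      exact longest_apply hN wA hwA.1 hwA.2 x hx
  exact fun p hp => ⟨fun h => (hst p hp).1 h.1, (hst p hp).2⟩
end
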